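/- (One-sided matching lemma.) Let σ = e₁,…,e_n and τ = f₁,…,f_ν be two legal sequences of Engel moves starting from the same configuration c, containing the same number of type-2 moves, and suppose that in the configuration obtained after performing all of τ no type-1 move is legal. Then for every transient state t, the number of type-1 moves at t occurring in σ is at most the number of type-1 moves at t occurring in τ. -/

import Mathlib

/-- A move in Engel's chip game: a type-1 move fires the transient state `i`,
a type-2 move adds a single chip at the distinguished starting state. -/
inductive EngelMove (s : ℕ) where
  | type1 (i : Fin s) : EngelMove s
  | type2 : EngelMove s
deriving DecidableEq

/-- The effect of a move on a configuration of chips: a type-1 move at `i` removes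
`ri i` chips from `i` and sends `rij i j` chips to each state `j`; a type-2 move adds
one chip at the distinguished state `u`. -/
def engelApply {s : ℕ} (u : Fin s) (ri : Fin s → ℕ) (rij : Fin s → Fin s → ℕ) :
    EngelMove s → (Fin s → ℕ) → (Fin s → ℕ)
  | .type1 i, c => fun j => c j - (if j = i then ri i else 0) + rij i j
  | .type2, c => fun j => c j + (if j = u then 1 else 0)

/-- Legality of a move in a configuration (`r` = number of transient states):
a type-1 move at `i` is legal iff `i` is transient and carries at least `ri i` chips;
type-2 moves are always allowed. -/
def engelLegal {s : ℕ} (r : ℕ) (ri : Fin s → ℕ) :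
    EngelMove s → (Fin s → ℕ) → Prop
  | .type1 i, c => (i : ℕ) < r ∧ ri i ≤ c i
  | .type2, _ => True

/-- A list of moves is a legal sequence from a configuration if every type-1 move in it
is legal in the configuration at which it is performed. -/
def engelLegalSeq {s : ℕ} (r : ℕ) (u : Fin s) (ri : Fin s → ℕ)
    (rij : Fin s → Fin s → ℕ) : (Fin s → ℕ) → List (EngelMove s) → Prop
  | _, [] => True
  | c, m :: ms => engelLegal r ri m c ∧
      engelLegalSeq r u ri rij (engelApply u ri rij m c) ms

/-- The configuration obtained after performing a list of moves. -/
def engelRun {s : ℕ} (u : Fin s) (ri : Fin s → ℕ) (rij : Fin s → Fin s → ℕ)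
    (c : Fin s → ℕ) (ms : List (EngelMove s)) : Fin s → ℕ :=
  ms.foldl (fun c m => engelApply u ri rij m c) c

theorem engelLegalSeq_append_singleton {s : ℕ} (r : ℕ) (u : Fin s) (ri : Fin s → ℕ)
    (rij : Fin s → Fin s → ℕ) (m : EngelMove s) (l : List (EngelMove s)) (c : Fin s → ℕ) :
    engelLegalSeq r u ri rij c (l ++ [m]) ↔
      engelLegalSeq r u ri rij c l ∧ engelLegal r ri m (engelRun u ri rij c l) := by
  induction l generalizing c with
  | nil => simp [engelLegalSeq, engelRun]
  | cons a l ih =>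
    simp only [List.cons_append, engelLegalSeq, ih, engelRun, List.foldl_cons, and_assoc]

/-- Chip conservation at a state `j`: the final number of chips plus the chips fired away
equals the initial number plus the chips received. -/
theorem engelRun_add_count_mul {s : ℕ} (r : ℕ) (u : Fin s) (ri : Fin s → ℕ)
    (rij : Fin s → Fin s → ℕ) (l : List (EngelMove s)) (c : Fin s → ℕ)
    (hl : engelLegalSeq r u ri rij c l) (j : Fin s) :
    engelRun u ri rij c l j + l.count (.type1 j) * ri j =
      c j + ∑ i, l.count (.type1 i) * rij i j +
        l.count .type2 * (if j = u then 1 else 0) := by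
  induction l generalizing c with
  | nil => simp [engelRun]
  | cons m l ih =>
    obtain ⟨hm, hl⟩ := hl
    have h := ih _ hl
    change engelRun u ri rij (engelApply u ri rij m c) l j + _ = _
    cases m with
    | type1 k =>
      have hsum : ∑ i, (EngelMove.type1 k :: l).count (.type1 i) * rij i j =
          ∑ i, l.count (.type1 i) * rij i j + rij k j := by
        simp [List.count_cons, add_mul, Finset.sum_add_distrib]
      rw [hsum]
      by_cases hjk : j = k
      · subst hjk
        have hle : ri j ≤ c j := hm.2
        simp only [engelApply, if_true] at h
        simp only [List.count_cons_self, add_mul, one_mul, engelApply,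
          List.count_cons_of_ne (by simp : EngelMove.type1 j ≠ EngelMove.type2)]
        omega
      · simp only [engelApply, if_neg hjk] at h
        simp only [engelApply,
          List.count_cons_of_ne (by simp [Ne.symm hjk] : EngelMove.type1 k ≠ .type1 j),
          List.count_cons_of_ne (by simp : EngelMove.type1 k ≠ EngelMove.type2)]
        omega
    | type2 =>
      have hne (i : Fin s) : (EngelMove.type2 :: l).count (.type1 i) = l.count (.type1 i) :=
        List.count_cons_of_ne (by simp)
      simp only [hne, List.count_cons_self, add_mul, one_mul]
      simp only [engelApply] at h ⊢
      omega

theorem count_type1_le_of_count_type2_le {s : ℕ} (r : ℕ) (u : Fin s) (ri : Fin s → ℕ)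
    (rij : Fin s → Fin s → ℕ) (c : Fin s → ℕ) (σ τ : List (EngelMove s))
    (hσ : engelLegalSeq r u ri rij c σ) (hτ : engelLegalSeq r u ri rij c τ)
    (hcount : σ.count .type2 ≤ τ.count .type2)
    (hfinal : ∀ i : Fin s, ¬ engelLegal r ri (.type1 i) (engelRun u ri rij c τ))
    (t : Fin s) : σ.count (.type1 t) ≤ τ.count (.type1 t) := by
  induction σ using List.reverseRecOn generalizing t with
  | nil => simp
  | append_singleton l m ih =>
    obtain ⟨hl, hm⟩ := (engelLegalSeq_append_singleton r u ri rij m l c).1 hσ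
    have hcl : l.count .type2 ≤ τ.count .type2 :=
      ((List.sublist_append_left l [m]).count_le _).trans hcount
    have hle := ih hl hcl
    rw [List.count_append]
    by_cases hmt : m = .type1 t
    · subst hmt
      rw [List.count_singleton_self]
      by_contra hlt
      have heq : l.count (.type1 t) = τ.count (.type1 t) := by
        have := hle t
        omega
      have hrl := engelRun_add_count_mul r u ri rij l c hl t
      have hrτ := engelRun_add_count_mul r u ri rij τ c hτ t
      have hin : ∑ i, l.count (.type1 i) * rij i t ≤ ∑ i, τ.count (.type1 i) * rij i t :=
        Finset.sum_le_sum fun i _ => Nat.mul_le_mul_right _ (hle i)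
      have hadd := Nat.mul_le_mul_right (if t = u then 1 else 0) hcl
      rw [heq] at hrl
      exact hfinal t ⟨hm.1, hm.2.trans (by omega)⟩
    · simpa [List.count_singleton, hmt] using hle t

/-- **one-sided matching lemma.** If `σ` and `τ` are legal sequences of
Engel moves from the same configuration `c` containing the same number of type-2 moves,
and no type-1 move is legal in the configuration obtained after performing all of `τ`,
then for every transient state `t`, the number of type-1 moves at `t` in `σ` is at most
the number of type-1 moves at `t` in `τ`. -/
theorem engel_matching_lemma
    (r s : ℕ) (hr : 1 ≤ r) (hrs : r < s)
    (u : Fin s) (hu : (u : ℕ) < r)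
    (ri : Fin s → ℕ) (hri : ∀ i : Fin s, (i : ℕ) < r → 0 < ri i)
    (rij : Fin s → Fin s → ℕ)
    (hsum : ∀ i : Fin s, (i : ℕ) < r → ∑ j, rij i j = ri i)
    (c : Fin s → ℕ) (σ τ : List (EngelMove s))
    (hσ : engelLegalSeq r u ri rij c σ)
    (hτ : engelLegalSeq r u ri rij c τ)
    (hcount2 : σ.count EngelMove.type2 = τ.count EngelMove.type2)
    (hτfinal : ∀ i : Fin s,
      ¬ engelLegal r ri (EngelMove.type1 i) (engelRun u ri rij c τ)) :
    ∀ t : Fin s, (t : ℕ) < r →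
      σ.count (EngelMove.type1 t) ≤ τ.count (EngelMove.type1 t) := by
  exact fun t _ => count_type1_le_of_count_type2_le r u ri rij c σ τ hσ hτ hcount2.le hτfinal t
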